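/- arXiv:2106.02109 — 10 statements merged into one kernel-verified Lean document; each statement's English description precedes it below -/
import Mathlib

section
/- The functions x ↦ a_𝓛(x) − a_p(x) and x ↦ a_𝓡(x) − a_p(x) are strictly decreasing on the interval [e/2, ∞). -/
noncomputable def L (x : ℝ) : ℝ := Real.pi ^ (1 / (2 * x)) * Real.exp (1 / ((12 * x + 1) * x))
noncomputable def R (x : ℝ) : ℝ := Real.pi ^ (1 / (2 * x)) * Real.exp (1 / (12 * x ^ 2))
noncomputable def P (x : ℝ) : ℝ := x ^ (1 / x)
noncomputable def aF (F : ℝ → ℝ) (x : ℝ) : ℝ := (F x - 1) * x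
noncomputable def calL (x : ℝ) : ℝ := L x * P (2 * x)
noncomputable def calR (x : ℝ) : ℝ := R x * P (2 * x)
noncomputable def p (x : ℝ) : ℝ := P (2 * x)

/-- The map `u ↦ (exp u - 1) / u` is strictly increasing on the positive reals. -/
theorem exp_sub_one_div_self_strictMonoOn :
    StrictMonoOn (fun u : ℝ => (Real.exp u - 1) / u) (Set.Ioi 0) := by
  intro b hb a ha hab
  have h := strictConvexOn_exp.secant_strict_mono (Set.mem_univ 0) (Set.mem_univ b)
    (Set.mem_univ a) (ne_of_gt hb) (ne_of_gt ha) hab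
  simpa using h

theorem exp_div_self_sub_one_mul_strictAntiOn {g : ℝ → ℝ} (hg : AntitoneOn g (Set.Ioi 0))
    (hpos : ∀ x, 0 < x → 0 < g x) :
    StrictAntiOn (fun x => (Real.exp (g x / x) - 1) * x) (Set.Ioi 0) := by
  intro x (hx : 0 < x) y (hy : 0 < y) hxy
  have hle : g y ≤ g x := hg hx hy hxy.le
  have hgx := hpos x hx
  have hgy := hpos y hy
  have hlt : g y / y < g x / x := div_lt_div₀' hle hxy hgx hx
  have hslope := exp_sub_one_div_self_strictMonoOn (div_pos hgy hy) (div_pos hgx hx) hlt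
  have hnonneg : 0 ≤ (Real.exp (g x / x) - 1) / (g x / x) :=
    div_nonneg (sub_nonneg.2 (Real.one_le_exp (div_pos hgx hx).le)) (div_pos hgx hx).le
  calc (Real.exp (g y / y) - 1) * y
      = (Real.exp (g y / y) - 1) / (g y / y) * g y := by field_simp
    _ < (Real.exp (g x / x) - 1) / (g x / x) * g y := mul_lt_mul_of_pos_right hslope hgy
    _ ≤ (Real.exp (g x / x) - 1) / (g x / x) * g x := mul_le_mul_of_nonneg_left hle hnonneg
    _ = (Real.exp (g x / x) - 1) * x := by field_simp

theorem p_pos {x : ℝ} (hx : 0 < x) : 0 < p x :=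
  Real.rpow_pos_of_pos (by positivity) _

theorem p_antitoneOn : AntitoneOn p (Set.Ici (Real.exp 1 / 2)) := by
  intro x (hx : _ ≤ x) y (hy : _ ≤ y) hxy
  have he := Real.exp_pos 1
  have h := Real.log_div_self_antitoneOn (show Real.exp 1 ≤ 2 * x by linarith)
    (show Real.exp 1 ≤ 2 * y by linarith) (by linarith)
  simp only [p, P]
  rw [Real.rpow_def_of_pos (by linarith), Real.rpow_def_of_pos (by linarith)]
  simpa [div_eq_mul_inv] using h

/-- If `F x = exp (g x / x)` for a positive antitone `g`, then multiplying `p` by `F` changes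
`aF p` by a strictly decreasing function. -/
theorem aF_mul_p_sub_aF_p_strictAntiOn {F g : ℝ → ℝ} (hg : AntitoneOn g (Set.Ioi 0))
    (hpos : ∀ x, 0 < x → 0 < g x) (hF : ∀ x, 0 < x → F x = Real.exp (g x / x)) :
    StrictAntiOn (fun x => aF (fun t => F t * P (2 * t)) x - aF p x)
      (Set.Ici (Real.exp 1 / 2)) := by
  intro x (hx : _ ≤ x) y (hy : _ ≤ y) hxy
  have hx0 : 0 < x := lt_of_lt_of_le (by positivity) hx
  have hy0 : 0 < y := hx0.trans hxy
  have hlt := exp_div_self_sub_one_mul_strictAntiOn hg hpos hx0 hy0 hxy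
  have hfactor : ∀ t, 0 < t →
      aF (fun t => F t * P (2 * t)) t - aF p t = (Real.exp (g t / t) - 1) * t * p t := by
    intro t ht
    simp only [aF, p, hF t ht]
    ring
  simp only [hfactor x hx0, hfactor y hy0]
  have hnonneg : 0 ≤ (Real.exp (g x / x) - 1) * x :=
    mul_nonneg (sub_nonneg.2 (Real.one_le_exp (div_pos (hpos x hx0) hx0).le)) hx0.le
  exact mul_lt_mul hlt (p_antitoneOn hx hy hxy.le) (p_pos hy0) hnonneg

theorem L_eq_exp {x : ℝ} (hx : 0 < x) :
    L x = Real.exp ((Real.log Real.pi / 2 + 1 / (12 * x + 1)) / x) := by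
  rw [L, Real.rpow_def_of_pos Real.pi_pos, ← Real.exp_add]
  congr 1
  field_simp

theorem R_eq_exp {x : ℝ} (hx : 0 < x) :
    R x = Real.exp ((Real.log Real.pi / 2 + 1 / (12 * x)) / x) := by
  rw [R, Real.rpow_def_of_pos Real.pi_pos, ← Real.exp_add]
  congr 1
  field_simp

theorem stmt1 :
    StrictAntiOn (fun x => aF calL x - aF p x) (Set.Ici (Real.exp 1 / 2)) ∧
    StrictAntiOn (fun x => aF calR x - aF p x) (Set.Ici (Real.exp 1 / 2)) := by
  have hlog : 0 < Real.log Real.pi := Real.log_pos (by linarith [Real.pi_gt_three])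
  constructor
  · refine aF_mul_p_sub_aF_p_strictAntiOn (F := L) ?_ (fun x hx => ?_) fun x hx => L_eq_exp hx
    · intro x (hx : 0 < x) y _ hxy
      dsimp only
      gcongr
    · positivity
  · refine aF_mul_p_sub_aF_p_strictAntiOn (F := R) ?_ (fun x hx => ?_) fun x hx => R_eq_exp hx
    · intro x (hx : 0 < x) y _ hxy
      dsimp only
      gcongr
    · positivity
end

section
/- As x → ∞, a_𝓛(x) − a_p(x) → (ln π)/2, a_𝓡(x) − a_p(x) → (ln π)/2, and a_𝓡(x) − a_𝓛(x) → 0. -/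
/-- If `x * g x → c`, then `x * (exp (g x) - 1) → c` as `x → ∞`. -/
theorem tendsto_exp_sub_one_mul_atTop {g : ℝ → ℝ} {c : ℝ}
    (hg : Filter.Tendsto (fun x => x * g x) Filter.atTop (nhds c)) :
    Filter.Tendsto (fun x => (Real.exp (g x) - 1) * x) Filter.atTop (nhds c) := by
  have hg0 : Filter.Tendsto g Filter.atTop (nhds 0) := by
    have h := tendsto_inv_atTop_zero.mul hg
    rw [zero_mul] at h
    refine h.congr' ?_
    filter_upwards [Filter.eventually_gt_atTop 0] with x hx
    field_simp
  have h := (Real.hasDerivAt_exp 0).hasFDerivAt.hasFDerivWithinAt (s := Set.univ)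
  have := h.lim (c := fun x : ℝ => x) hg0 (by simp) (by simpa using hg)
  simpa [mul_comm] using this

theorem tendsto_p_atTop : Filter.Tendsto p Filter.atTop (nhds 1) :=
  tendsto_rpow_div.comp (Filter.tendsto_id.const_mul_atTop (by norm_num : (0 : ℝ) < 2))

/-- Multiplying `p` by `π ^ (1 / (2 * x)) * exp (e x)` with `e x = o(1 / x)` shifts `aF p`
by `log π / 2` in the limit. -/
theorem tendsto_aF_mul_p_sub_aF_p {e : ℝ → ℝ}
    (he : Filter.Tendsto (fun x => x * e x) Filter.atTop (nhds 0)) :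
    Filter.Tendsto
      (fun x => aF (fun x => Real.pi ^ (1 / (2 * x)) * Real.exp (e x) * P (2 * x)) x - aF p x)
      Filter.atTop (nhds (Real.log Real.pi / 2)) := by
  have hg : Filter.Tendsto (fun x => x * (Real.log Real.pi * (1 / (2 * x)) + e x)) Filter.atTop
      (nhds (Real.log Real.pi / 2)) := by
    rw [← add_zero (Real.log Real.pi / 2)]
    refine (he.const_add (Real.log Real.pi / 2)).congr' ?_
    filter_upwards [Filter.eventually_gt_atTop 0] with x hx
    field_simp
  have h := (tendsto_exp_sub_one_mul_atTop hg).mul tendsto_p_atTop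
  rw [mul_one] at h
  refine h.congr fun x => ?_
  rw [Real.exp_add, ← Real.rpow_def_of_pos Real.pi_pos]
  simp only [aF, p]
  ring

theorem stmt2 :
    Filter.Tendsto (fun x => aF calL x - aF p x) Filter.atTop (nhds (Real.log Real.pi / 2)) ∧
    Filter.Tendsto (fun x => aF calR x - aF p x) Filter.atTop (nhds (Real.log Real.pi / 2)) ∧
    Filter.Tendsto (fun x => aF calR x - aF calL x) Filter.atTop (nhds 0) := by
  have hL : Filter.Tendsto (fun x => aF calL x - aF p x) Filter.atTop
      (nhds (Real.log Real.pi / 2)) := by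
    refine tendsto_aF_mul_p_sub_aF_p (e := fun x => 1 / ((12 * x + 1) * x)) ?_
    have hlin : Filter.Tendsto (fun x : ℝ => 12 * x + 1) Filter.atTop Filter.atTop :=
      Filter.tendsto_atTop_add_const_right _ _
        (Filter.tendsto_id.const_mul_atTop (by norm_num : (0 : ℝ) < 12))
    refine (tendsto_inv_atTop_zero.comp hlin).congr' ?_
    filter_upwards [Filter.eventually_gt_atTop 0] with x hx
    simp only [Function.comp_apply]
    field_simp
  have hR : Filter.Tendsto (fun x => aF calR x - aF p x) Filter.atTop
      (nhds (Real.log Real.pi / 2)) := by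
    refine tendsto_aF_mul_p_sub_aF_p (e := fun x => 1 / (12 * x ^ 2)) ?_
    have hlin : Filter.Tendsto (fun x : ℝ => 12 * x) Filter.atTop Filter.atTop :=
      Filter.tendsto_id.const_mul_atTop (by norm_num : (0 : ℝ) < 12)
    refine (tendsto_inv_atTop_zero.comp hlin).congr' ?_
    filter_upwards [Filter.eventually_gt_atTop 0] with x hx
    simp only [Function.comp_apply]
    field_simp
  refine ⟨hL, hR, ?_⟩
  simpa using hR.sub hL
end

section
/- For every positive integer n, a_𝓛(n) < σ_n < a_𝓡(n) + 1. -/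
/-- `sigma n` is the largest positive integer `ℓ` with `n + (ℓ - 1) ≤ e * (n!)^(1/n)`. -/
noncomputable def sigma (n : ℕ) : ℕ :=
  sSup {ℓ : ℕ | 0 < ℓ ∧ (n : ℝ) + ((ℓ : ℝ) - 1) ≤ Real.exp 1 * (n.factorial : ℝ) ^ ((1 : ℝ) / n)}

/-- Strict form of the stepwise upper bound for the logarithm of the Stirling sequence. -/
theorem log_stirlingSeq_sub_succ_lt (n : ℕ) :
    Real.log (Stirling.stirlingSeq (n + 1)) - Real.log (Stirling.stirlingSeq (n + 2)) <
      1 / (12 * ((n : ℝ) + 1)) - 1 / (12 * ((n : ℝ) + 2)) := by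
  set r := ((1 : ℝ) / (2 * ((n : ℝ) + 1) + 1)) ^ 2 with hr
  have hn : (0 : ℝ) ≤ n := n.cast_nonneg
  have hr0 : 0 < r := by positivity
  have hr1 : r < 1 := by
    rw [hr, div_pow, one_pow, div_lt_one (by positivity)]
    nlinarith
  have hgeom : HasSum (fun j ↦ r ^ (j + 1) / 3)
      (1 / (12 * ((n : ℝ) + 1)) - 1 / (12 * ((n : ℝ) + 2))) := by
    have h := ((hasSum_geometric_of_lt_one hr0.le hr1).mul_right r).div_const 3
    have hval : (1 - r)⁻¹ * r / 3 = 1 / (12 * ((n : ℝ) + 1)) - 1 / (12 * ((n : ℝ) + 2)) := by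
      have h1 : 1 - r = 4 * ((n : ℝ) + 1) * (n + 2) * r := by rw [hr]; field_simp; ring
      rw [h1]
      field_simp
      ring
    rw [hval] at h
    simpa only [pow_succ] using h
  have hterm (j : ℕ) : (1 : ℝ) / (2 * ((j + 1 : ℕ) : ℝ) + 1) ≤ 1 / 3 := by
    apply one_div_le_one_div_of_le (by norm_num)
    push_cast
    linarith [(j.cast_nonneg : (0 : ℝ) ≤ j)]
  have hsum := Stirling.log_stirlingSeq_sdiff_hasSum n
  push_cast at hsum hterm
  refine hasSum_lt (i := 1) (fun j ↦ ?_) ?_ hsum hgeom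
  · have := mul_le_mul_of_nonneg_right (hterm j) (pow_pos hr0 (j + 1)).le
    rw [hr] at this ⊢
    linarith
  · have : 0 < r ^ 2 := by positivity
    rw [hr] at this ⊢
    norm_num only [Nat.cast_one] at this ⊢
    linarith

/-- Strict form of the stepwise lower bound for the logarithm of the Stirling sequence. -/
theorem lt_log_stirlingSeq_sub_succ (n : ℕ) :
    1 / (12 * ((n : ℝ) + 1) + 1) - 1 / (12 * ((n : ℝ) + 2) + 1) <
      Real.log (Stirling.stirlingSeq (n + 1)) - Real.log (Stirling.stirlingSeq (n + 2)) := by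
  have hn : (0 : ℝ) ≤ n := n.cast_nonneg
  refine lt_of_lt_of_le ?_
    (le_hasSum (Stirling.log_stirlingSeq_sdiff_hasSum n) 0 fun j _ ↦ by positivity)
  push_cast
  rw [div_sub_div _ _ (by positivity) (by positivity), pow_one, div_pow,
    div_mul_div_comm, div_lt_div_iff₀ (by positivity) (by positivity)]
  nlinarith

theorem tendsto_log_stirlingSeq_succ :
    Filter.Tendsto (fun n : ℕ ↦ Real.log (Stirling.stirlingSeq (n + 1))) Filter.atTop
      (nhds (Real.log Real.pi / 2)) := by
  rw [← Real.log_sqrt Real.pi_pos.le]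
  exact ((Stirling.tendsto_stirlingSeq_sqrt_pi.log (Real.sqrt_pos.2 Real.pi_pos).ne').comp
    (Filter.tendsto_add_atTop_nat 1))

theorem log_stirlingSeq_lt {n : ℕ} (hn : 0 < n) :
    Real.log (Stirling.stirlingSeq n) < Real.log Real.pi / 2 + 1 / (12 * n) := by
  obtain ⟨m, rfl⟩ := Nat.exists_eq_add_of_lt hn
  let u : ℕ → ℝ := fun k ↦ Real.log (Stirling.stirlingSeq (k + 1)) - 1 / 12 * (1 / ((k : ℝ) + 1))
  have hu (k : ℕ) : u k < u (k + 1) := by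
    have := log_stirlingSeq_sub_succ_lt k
    simp only [u, one_div_mul_one_div]
    push_cast
    rw [add_assoc (k : ℝ) 1 1, one_add_one_eq_two]
    linarith
  have hlim : Filter.Tendsto u Filter.atTop (nhds (Real.log Real.pi / 2)) := by
    simpa only [mul_zero, sub_zero] using tendsto_log_stirlingSeq_succ.sub
      (tendsto_one_div_add_atTop_nhds_zero_nat.const_mul (1 / 12))
  have h := (hu m).trans_le ((strictMono_nat_of_lt_succ hu).monotone.ge_of_tendsto hlim (m + 1))
  simp only [u, one_div_mul_one_div] at h
  rw [zero_add]
  push_cast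
  linarith

theorem lt_log_stirlingSeq {n : ℕ} (hn : 0 < n) :
    Real.log Real.pi / 2 + 1 / (12 * n + 1) < Real.log (Stirling.stirlingSeq n) := by
  obtain ⟨m, rfl⟩ := Nat.exists_eq_add_of_lt hn
  let u : ℕ → ℝ := fun k ↦ Real.log (Stirling.stirlingSeq (k + 1)) - 1 / (12 * ((k : ℝ) + 1) + 1)
  have hu (k : ℕ) : u (k + 1) < u k := by
    have := lt_log_stirlingSeq_sub_succ k
    simp only [u]
    push_cast
    rw [add_assoc (k : ℝ) 1 1, one_add_one_eq_two]
    linarith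
  have hzero : Filter.Tendsto (fun k : ℕ ↦ 1 / (12 * ((k : ℝ) + 1) + 1)) Filter.atTop (nhds 0) :=
    squeeze_zero (fun k ↦ by positivity)
      (fun k ↦ one_div_le_one_div_of_le (by positivity) (by linarith [(k.cast_nonneg : (0 : ℝ) ≤ k)]))
      tendsto_one_div_add_atTop_nhds_zero_nat
  have hlim : Filter.Tendsto u Filter.atTop (nhds (Real.log Real.pi / 2)) := by
    simpa [u] using tendsto_log_stirlingSeq_succ.sub hzero
  have h := ((strictAnti_nat_of_succ_lt hu).antitone.le_of_tendsto hlim (m + 1)).trans_lt (hu m)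
  simp only [u] at h
  rw [zero_add]
  push_cast
  linarith

theorem exp_one_mul_factorial_rpow {n : ℕ} (hn : 0 < n) :
    Real.exp 1 * (n.factorial : ℝ) ^ ((1 : ℝ) / n) =
      Real.exp ((Real.log (Stirling.stirlingSeq n) + Real.log (2 * n) / 2) / n) * n := by
  have hn' : (0 : ℝ) < n := Nat.cast_pos.2 hn
  nth_rewrite 4 [← Real.exp_log hn']
  rw [Real.rpow_def_of_pos (by positivity), ← Real.exp_add, ← Real.exp_add,
    Stirling.log_stirlingSeq_formula, Real.log_div hn'.ne' (Real.exp_pos 1).ne', Real.log_exp]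
  congr 1
  field_simp
  ring

theorem calL_eq_exp {x : ℝ} (hx : 0 < x) :
    calL x =
      Real.exp ((Real.log Real.pi / 2 + 1 / (12 * x + 1) + Real.log (2 * x) / 2) / x) := by
  unfold calL L P
  rw [Real.rpow_def_of_pos Real.pi_pos, Real.rpow_def_of_pos (by positivity), ← Real.exp_add,
    ← Real.exp_add]
  congr 1
  field_simp

theorem calR_eq_exp {x : ℝ} (hx : 0 < x) :
    calR x = Real.exp ((Real.log Real.pi / 2 + 1 / (12 * x) + Real.log (2 * x) / 2) / x) := by
  unfold calR R P
  rw [Real.rpow_def_of_pos Real.pi_pos, Real.rpow_def_of_pos (by positivity), ← Real.exp_add,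
    ← Real.exp_add]
  congr 1
  field_simp

theorem calL_mul_lt {n : ℕ} (hn : 0 < n) :
    calL n * n < Real.exp 1 * (n.factorial : ℝ) ^ ((1 : ℝ) / n) := by
  have hn' : (0 : ℝ) < n := Nat.cast_pos.2 hn
  rw [exp_one_mul_factorial_rpow hn, calL_eq_exp hn']
  have := lt_log_stirlingSeq hn
  gcongr

theorem lt_calR_mul {n : ℕ} (hn : 0 < n) :
    Real.exp 1 * (n.factorial : ℝ) ^ ((1 : ℝ) / n) < calR n * n := by
  have hn' : (0 : ℝ) < n := Nat.cast_pos.2 hn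
  rw [exp_one_mul_factorial_rpow hn, calR_eq_exp hn']
  have := log_stirlingSeq_lt hn
  gcongr

theorem one_le_calL {n : ℕ} (hn : 0 < n) : 1 ≤ calL n := by
  have hn' : (1 : ℝ) ≤ n := Nat.one_le_cast.2 hn
  have h1 : 0 ≤ Real.log Real.pi := Real.log_nonneg (by linarith [Real.pi_gt_three])
  have h2 : 0 ≤ Real.log (2 * n) := Real.log_nonneg (by linarith)
  rw [calL_eq_exp (by linarith)]
  exact Real.one_le_exp (by positivity)

theorem sigma_eq_floor_add_one {n : ℕ} (hn : 0 < n) :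
    sigma n = ⌊Real.exp 1 * (n.factorial : ℝ) ^ ((1 : ℝ) / n) - n⌋₊ + 1 := by
  have hn' : (0 : ℝ) < n := Nat.cast_pos.2 hn
  have hE : 0 ≤ Real.exp 1 * (n.factorial : ℝ) ^ ((1 : ℝ) / n) - n := by
    nlinarith [calL_mul_lt hn, one_le_calL hn]
  refine IsGreatest.csSup_eq ⟨⟨Nat.succ_pos _, ?_⟩, fun l ⟨hl, h⟩ ↦ ?_⟩
  · push_cast
    linarith [Nat.floor_le hE]
  · obtain ⟨k, rfl⟩ := Nat.exists_eq_add_of_lt hl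
    push_cast at h
    have hk : (k : ℝ) ≤ Real.exp 1 * (n.factorial : ℝ) ^ ((1 : ℝ) / n) - n := by linarith
    rw [zero_add]
    exact Nat.succ_le_succ (Nat.le_floor hk)

theorem stmt3 : ∀ n : ℕ, 0 < n →
    aF calL n < (sigma n : ℝ) ∧ (sigma n : ℝ) < aF calR n + 1 := by
  intro n hn
  have hn' : (0 : ℝ) < n := Nat.cast_pos.2 hn
  have hL := calL_mul_lt hn
  have hR := lt_calR_mul hn
  have hE : 0 ≤ Real.exp 1 * (n.factorial : ℝ) ^ ((1 : ℝ) / n) - n := by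
    nlinarith [one_le_calL hn]
  rw [sigma_eq_floor_add_one hn]
  unfold aF
  push_cast
  constructor
  · linarith [Nat.lt_floor_add_one (Real.exp 1 * (n.factorial : ℝ) ^ ((1 : ℝ) / n) - n)]
  · linarith [Nat.floor_le hE]
end

section
/- For every integer n ≥ 2, ln(2n)·QL(n) < σ_n < ln(2n)·QR(n) + 1. -/
noncomputable def QL (x : ℝ) : ℝ :=
  (Real.log Real.pi / 2) / Real.log (2 * x) + (1 / 2) * (1 + (Real.log Real.pi / 2) / x)
noncomputable def QR (x : ℝ) : ℝ :=
  (2 / Real.log (2 * x) + 1) * (x / (2 * x - Real.log (2 * x)))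
noncomputable def D (x : ℝ) : ℝ := Real.log (2 * x) * QR x - Real.log (2 * x) * QL x

theorem exp_mul_one_sub_le_one (x : ℝ) : Real.exp x * (1 - x) ≤ 1 := by
  calc Real.exp x * (1 - x) ≤ Real.exp x * Real.exp (-x) := by
        gcongr
        exact Real.one_sub_le_exp_neg x
    _ = 1 := by rw [← Real.exp_add, add_neg_cancel, Real.exp_zero]

theorem log_factorial_lower {n : ℕ} (hn : 2 ≤ n) :
    n * Real.log n - n + Real.log (2 * n) / 2 + Real.log Real.pi / 2
      ≤ Real.log (n.factorial : ℝ) := by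
  have h := Stirling.le_log_factorial_stirling (n := n) (by omega)
  have hn0 : (n : ℝ) ≠ 0 := by positivity
  have e1 : Real.log (2 * n) = Real.log 2 + Real.log n := Real.log_mul (by norm_num) hn0
  have e2 : Real.log (2 * Real.pi) = Real.log 2 + Real.log Real.pi :=
    Real.log_mul (by norm_num) Real.pi_ne_zero
  linarith

theorem log_factorial_upper {n : ℕ} (hn : 2 ≤ n) :
    Real.log (n.factorial : ℝ)
      ≤ n * Real.log n - n + Real.log (2 * n) / 2 + (1 - Real.log 2 / 2) := by
  obtain ⟨m, rfl⟩ : ∃ m, n = m + 1 := ⟨n - 1, by omega⟩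
  have h : Real.log (Stirling.stirlingSeq (m + 1)) ≤ Real.log (Stirling.stirlingSeq 1) :=
    Stirling.log_stirlingSeq'_antitone (Nat.zero_le m)
  have hm : ((m + 1 : ℕ) : ℝ) ≠ 0 := by positivity
  rw [Stirling.log_stirlingSeq_formula, Stirling.stirlingSeq_one,
    Real.log_div (Real.exp_ne_zero 1) (by positivity), Real.log_exp,
    Real.log_sqrt (by norm_num), Real.log_div hm (Real.exp_ne_zero 1), Real.log_exp] at h
  linarith

theorem exp_mul_factorial_rpow {n : ℕ} (hn : 2 ≤ n) :
    Real.exp 1 * (n.factorial : ℝ) ^ ((1 : ℝ) / n) =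
      n * Real.exp ((Real.log (n.factorial : ℝ) - n * Real.log n + n) / n) := by
  have hn0 : (0 : ℝ) < n := by positivity
  have hf : (0 : ℝ) < n.factorial := by exact_mod_cast n.factorial_pos
  conv_rhs => rw [← Real.exp_log hn0]
  rw [Real.rpow_def_of_pos hf, ← Real.exp_add, ← Real.exp_add, Real.exp_log hn0]
  congr 1
  field_simp
  ring

theorem sigma_bounds {n : ℕ}
    (h : (n : ℝ) ≤ Real.exp 1 * (n.factorial : ℝ) ^ ((1 : ℝ) / n)) :
    Real.exp 1 * (n.factorial : ℝ) ^ ((1 : ℝ) / n) - n < sigma n ∧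
      (sigma n : ℝ) ≤ Real.exp 1 * (n.factorial : ℝ) ^ ((1 : ℝ) / n) - n + 1 := by
  unfold sigma
  set M := Real.exp 1 * (n.factorial : ℝ) ^ ((1 : ℝ) / n)
  set S := {ℓ : ℕ | 0 < ℓ ∧ (n : ℝ) + ((ℓ : ℝ) - 1) ≤ M}
  have hbdd : BddAbove S := by
    refine ⟨⌊M - n + 1⌋₊, fun ℓ hl => Nat.le_floor ?_⟩
    linarith [hl.2]
  have hmem : ⌊M - n⌋₊ + 1 ∈ S := by
    refine ⟨Nat.succ_pos _, ?_⟩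
    have := Nat.floor_le (sub_nonneg.2 h)
    push_cast
    linarith
  constructor
  · have h1 : ((⌊M - n⌋₊ + 1 : ℕ) : ℝ) ≤ (sSup S : ℕ) := by exact_mod_cast le_csSup hbdd hmem
    have h2 := Nat.lt_floor_add_one (M - n)
    push_cast at h1
    linarith
  · linarith [(Nat.sSup_mem ⟨_, hmem⟩ hbdd).2]

theorem stmt5 : ∀ n : ℕ, 2 ≤ n →
    Real.log (2 * n) * QL n < (sigma n : ℝ) ∧
    (sigma n : ℝ) < Real.log (2 * n) * QR n + 1 := by
  intro n hn
  have hn2 : (2 : ℝ) ≤ n := by exact_mod_cast hn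
  have hn0 : (0 : ℝ) < n := by linarith
  have hL : 0 < Real.log (2 * n) := Real.log_pos (by linarith)
  have hα : 0 < Real.log Real.pi / 2 := by
    have := Real.log_pos (show 1 < Real.pi by linarith [Real.pi_gt_three])
    linarith
  have hL2 : Real.log (2 * n) < 2 * n := by
    linarith [Real.log_le_sub_one_of_pos (show (0 : ℝ) < 2 * n by linarith)]
  have hlow := log_factorial_lower hn
  have hup := log_factorial_upper hn
  have hM := exp_mul_factorial_rpow hn
  have hs := sigma_bounds (n := n)
  unfold QL QR
  rw [hM] at hs
  set L := Real.log (2 * n)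
  set α := Real.log Real.pi / 2
  set u := Real.log (n.factorial : ℝ) - n * Real.log n + n
  have hu : α + L / 2 ≤ u := by linarith
  have hu0 : 0 ≤ u := by linarith
  have hlower : n + L * (α / L + 1 / 2 * (1 + α / n)) ≤ n * Real.exp (u / n) := by
    have h1 := Real.quadratic_le_exp_of_nonneg (div_nonneg hu0 hn0.le)
    have h2 : (α + L / 2) ^ 2 ≤ u ^ 2 := by gcongr
    calc n + L * (α / L + 1 / 2 * (1 + α / n)) = n + (α + L / 2) + α * L / (2 * n) := by
          field_simp
          ring
      _ ≤ n + u + u ^ 2 / (2 * n) := by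
          gcongr
          nlinarith [sq_nonneg α, sq_nonneg L]
      _ = n * (1 + u / n + (u / n) ^ 2 / 2) := by field_simp
      _ ≤ _ := by gcongr
  have hupper : n * Real.exp (u / n) < n + L * ((2 / L + 1) * (n / (2 * n - L))) := by
    have hc : u ≤ L / 2 + 33 / 50 := by linarith [Real.log_two_gt_d9]
    have hA : Real.exp (L / 2 / n) * (1 - L / 2 / n) ≤ 1 := exp_mul_one_sub_le_one _
    have hB : Real.exp (33 / 50 / n) * (1 - 33 / 50 / n) ≤ 1 := exp_mul_one_sub_le_one _
    have hB' : Real.exp (33 / 50 / n) < 1 + 1 / n := by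
      have hd : (0 : ℝ) < 1 - 33 / 50 / n := by
        rw [sub_pos, div_lt_one hn0]
        linarith
      rw [← le_div_iff₀ hd] at hB
      refine hB.trans_lt ?_
      rw [div_lt_iff₀ hd]
      have : (1 + 1 / (n : ℝ)) * (1 - 33 / 50 / n) = 1 + (17 / 50 * n - 33 / 50) / n ^ 2 := by
        field_simp
        ring
      rw [this]
      have : 0 < (17 / 50 * n - 33 / 50) / (n : ℝ) ^ 2 := div_pos (by linarith) (by positivity)
      linarith
    have hd : 0 < 2 * n - L := by linarith
    have hA' : Real.exp (L / 2 / n) ≤ 2 * n / (2 * n - L) := by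
      rw [le_div_iff₀ hd]
      calc Real.exp (L / 2 / n) * (2 * n - L)
          = 2 * n * (Real.exp (L / 2 / n) * (1 - L / 2 / n)) := by field_simp
        _ ≤ 2 * n * 1 := by gcongr
        _ = 2 * n := mul_one _
    calc n * Real.exp (u / n) ≤ n * Real.exp ((L / 2 + 33 / 50) / n) := by gcongr
      _ = n * (Real.exp (L / 2 / n) * Real.exp (33 / 50 / n)) := by
        rw [add_div, Real.exp_add]
      _ < n * (2 * n / (2 * n - L) * (1 + 1 / n)) :=
        mul_lt_mul_of_pos_left (mul_lt_mul' hA' hB' (Real.exp_pos _).le (by positivity)) hn0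
      _ = _ := by
        have hL' : 2 * n = (2 * n - L) + L := by ring
        generalize 2 * n - L = d at hd hL' ⊢
        field_simp
        linear_combination hL'
  have hpos : 0 < L * (α / L + 1 / 2 * (1 + α / n)) := by positivity
  obtain ⟨h1, h2⟩ := hs (by linarith)
  exact ⟨by linarith, by linarith⟩
end

section
/- The functions QL and QR are positive valued and strictly decreasing on [e/2, ∞), and the function D is positive valued on [e/2, ∞) and strictly decreasing on [e²/2, ∞). -/
theorem log_pi_div_two_pos : 0 < Real.log Real.pi / 2 := by
  have := Real.log_pos (show (1 : ℝ) < Real.pi by linarith [Real.pi_gt_three])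
  linarith

theorem log_pi_div_two_lt_one : Real.log Real.pi / 2 < 1 := by
  have h4 : Real.log 4 = 2 * Real.log 2 := by
    rw [show (4 : ℝ) = 2 ^ 2 by norm_num, Real.log_pow]
    norm_num
  have := Real.log_lt_log Real.pi_pos Real.pi_lt_four
  linarith [Real.log_two_lt_d9]

theorem one_le_log_of_exp_one_le {y : ℝ} (hy : Real.exp 1 ≤ y) : 1 ≤ Real.log y :=
  (Real.le_log_iff_exp_le ((Real.exp_pos 1).trans_le hy)).2 hy

theorem log_div_self_lt_one {y : ℝ} (hy : 0 < y) : Real.log y / y < 1 := by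
  rw [div_lt_one hy]
  linarith [Real.log_le_sub_one_of_pos hy]

theorem log_div_self_strictAntiOn :
    StrictAntiOn (fun y : ℝ => Real.log y / y) (Set.Ici (Real.exp 1)) := by
  intro y hy z _ hyz
  have hy0 : 0 < y := (Real.exp_pos 1).trans_le hy
  have hz0 : 0 < z := hy0.trans hyz
  have hlog : Real.log z - Real.log y < z / y - 1 := by
    rw [← Real.log_div hz0.ne' hy0.ne']
    exact Real.log_lt_sub_one_of_pos (by positivity) ((one_lt_div hy0).2 hyz).ne'
  have hmul := mul_lt_mul_of_pos_left hlog hy0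
  have hcancel : y * (z / y - 1) = z - y := by field_simp
  have hle := mul_le_mul_of_nonneg_left (one_le_log_of_exp_one_le hy) (sub_pos.2 hyz).le
  dsimp only
  rw [div_lt_div_iff₀ hz0 hy0]
  linarith

theorem log_sq_div_self_antitoneOn :
    AntitoneOn (fun y : ℝ => Real.log y ^ 2 / y) (Set.Ici (Real.exp 2)) := by
  intro y hy z hz hyz
  have hz0 : 0 < z := (Real.exp_pos 2).trans_le hz
  have hy0 : 0 < y := (Real.exp_pos 2).trans_le hy
  have hz1 : 1 ≤ z := (Real.one_le_exp (by norm_num)).trans hz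
  have h := pow_le_pow_left₀ (div_nonneg (Real.log_nonneg hz1) (Real.sqrt_nonneg z))
    (Real.log_div_sqrt_antitoneOn hy hz hyz) 2
  simpa only [div_pow, Real.sq_sqrt hz0.le, Real.sq_sqrt hy0.le] using h

theorem QR_eq {x : ℝ} (hx : 0 < x) :
    QR x = (2 / Real.log (2 * x) + 1) * (1 / (2 * (1 - Real.log (2 * x) / (2 * x)))) := by
  have h := log_div_self_lt_one (y := 2 * x) (by positivity)
  have hne : 2 * x - Real.log (2 * x) ≠ 0 := by
    rw [div_lt_one (by positivity)] at h
    linarith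
  have hne' : 1 - Real.log (2 * x) / (2 * x) ≠ 0 := by linarith
  have hfac : 2 * x - Real.log (2 * x) = 2 * x * (1 - Real.log (2 * x) / (2 * x)) := by
    field_simp
  rw [QR, hfac]
  congr 1
  rw [div_eq_div_iff (mul_ne_zero (by positivity) hne') (mul_ne_zero two_ne_zero hne')]
  ring

theorem D_eq {x : ℝ} (hx : 0 < x) (hlog : Real.log (2 * x) ≠ 0) :
    D x = 1 / (1 - Real.log (2 * x) / (2 * x))
      + Real.log (2 * x) ^ 2 / (2 * x) * (1 / (1 - Real.log (2 * x) / (2 * x))) / 2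
      - Real.log Real.pi / 2 * (1 + Real.log (2 * x) / (2 * x)) := by
  have h := log_div_self_lt_one (y := 2 * x) (by positivity)
  have hsq : Real.log (2 * x) ^ 2 / (2 * x) = Real.log (2 * x) * (Real.log (2 * x) / (2 * x)) := by
    ring
  have hQL : Real.log (2 * x) * QL x = Real.log Real.pi / 2 * (1 + Real.log (2 * x) / (2 * x))
      + Real.log (2 * x) / 2 := by
    rw [QL]
    field_simp
    ring
  rw [D, hQL, QR_eq hx, hsq]
  have hne : 1 - Real.log (2 * x) / (2 * x) ≠ 0 := by linarith
  generalize Real.log (2 * x) / (2 * x) = t at hne ⊢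
  field_simp
  ring

theorem stmt6 :
    (∀ x ∈ Set.Ici (Real.exp 1 / 2), 0 < QL x) ∧
    StrictAntiOn QL (Set.Ici (Real.exp 1 / 2)) ∧
    (∀ x ∈ Set.Ici (Real.exp 1 / 2), 0 < QR x) ∧
    StrictAntiOn QR (Set.Ici (Real.exp 1 / 2)) ∧
    (∀ x ∈ Set.Ici (Real.exp 1 / 2), 0 < D x) ∧
    StrictAntiOn D (Set.Ici (Real.exp 1 ^ 2 / 2)) := by
  have hα := log_pi_div_two_pos
  have hα1 := log_pi_div_two_lt_one
  have hmem : ∀ x ∈ Set.Ici (Real.exp 1 / 2), 0 < x ∧ Real.exp 1 ≤ 2 * x := by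
    intro x hx
    have hx' : Real.exp 1 / 2 ≤ x := hx
    have := Real.exp_pos 1
    constructor <;> linarith
  have hexp : ∀ x ∈ Set.Ici (Real.exp 1 ^ 2 / 2), 0 < x ∧ Real.exp 2 ≤ 2 * x := by
    intro x hx
    have hx' : Real.exp 1 ^ 2 / 2 ≤ x := hx
    rw [← Real.exp_nat_mul] at hx'
    norm_num at hx'
    have := Real.exp_pos 2
    constructor <;> linarith
  refine ⟨?_, ?_, ?_, ?_, ?_, ?_⟩
  · intro x hx
    obtain ⟨hx0, hxe⟩ := hmem x hx
    have hlog := one_le_log_of_exp_one_le hxe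
    rw [QL]
    positivity
  · intro x hx z hz hxz
    obtain ⟨hx0, hxe⟩ := hmem x hx
    have hlog := one_le_log_of_exp_one_le hxe
    have hlt := Real.log_lt_log (by positivity) (show 2 * x < 2 * z by linarith)
    have h1 := div_lt_div_of_pos_left hα (by linarith) hlt
    have h2 := div_lt_div_of_pos_left hα hx0 hxz
    simp only [QL]
    linarith
  · intro x hx
    obtain ⟨hx0, hxe⟩ := hmem x hx
    have hlog := one_le_log_of_exp_one_le hxe
    have ht := sub_pos.2 (log_div_self_lt_one (y := 2 * x) (by positivity))
    rw [QR_eq hx0]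
    positivity
  · intro x hx z hz hxz
    obtain ⟨hx0, hxe⟩ := hmem x hx
    obtain ⟨hz0, hze⟩ := hmem z hz
    have hlog := one_le_log_of_exp_one_le hxe
    have hlt := Real.log_lt_log (by positivity) (show 2 * x < 2 * z by linarith)
    have ht := sub_pos.2 (log_div_self_lt_one (y := 2 * x) (by positivity))
    have hts : Real.log (2 * z) / (2 * z) < Real.log (2 * x) / (2 * x) :=
      log_div_self_strictAntiOn hxe hze (by linarith)
    rw [QR_eq hx0, QR_eq hz0]
    have h1 := div_lt_div_of_pos_left (two_pos (α := ℝ)) (by linarith) hlt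
    have hz1 : 0 < 1 - Real.log (2 * z) / (2 * z) := by linarith
    exact mul_lt_mul'' (by linarith) (one_div_lt_one_div_of_lt (by linarith) (by linarith))
      (by have : 0 < Real.log (2 * z) := by linarith
          positivity) (by positivity)
  · intro x hx
    obtain ⟨hx0, hxe⟩ := hmem x hx
    have hlog := one_le_log_of_exp_one_le hxe
    have ht := log_div_self_lt_one (y := 2 * x) (by positivity)
    have ht' := sub_pos.2 ht
    have ht0 : 0 < Real.log (2 * x) / (2 * x) := by positivity
    rw [D_eq hx0 (by linarith)]
    have h1 : 1 + Real.log (2 * x) / (2 * x) ≤ 1 / (1 - Real.log (2 * x) / (2 * x)) := by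
      rw [le_div_iff₀ ht']
      nlinarith
    have h2 : 0 < Real.log (2 * x) ^ 2 / (2 * x) * (1 / (1 - Real.log (2 * x) / (2 * x))) / 2 := by
      positivity
    nlinarith
  · intro x hx z hz hxz
    obtain ⟨hx0, hxe⟩ := hexp x hx
    obtain ⟨hz0, hze⟩ := hexp z hz
    have he : Real.exp 1 ≤ Real.exp 2 := Real.exp_le_exp.2 (by norm_num)
    have hlog := one_le_log_of_exp_one_le (he.trans hxe)
    have hlogz := one_le_log_of_exp_one_le (he.trans hze)
    have ht := sub_pos.2 (log_div_self_lt_one (y := 2 * x) (by positivity))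
    have hts : Real.log (2 * z) / (2 * z) < Real.log (2 * x) / (2 * x) :=
      log_div_self_strictAntiOn (he.trans hxe) (he.trans hze) (by linarith)
    have hs0 : 0 < Real.log (2 * z) / (2 * z) := by positivity
    have hsq : Real.log (2 * z) ^ 2 / (2 * z) ≤ Real.log (2 * x) ^ 2 / (2 * x) :=
      log_sq_div_self_antitoneOn hxe hze (by linarith)
    have hsq0 : 0 ≤ Real.log (2 * x) ^ 2 / (2 * x) := by positivity
    rw [D_eq hx0 (by linarith), D_eq hz0 (by linarith)]
    generalize Real.log (2 * x) / (2 * x) = t at *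
    generalize Real.log (2 * z) / (2 * z) = s at *
    have hs : 0 < 1 - s := by linarith
    have hinv : 1 / (1 - s) ≤ 1 / (1 - t) := one_div_le_one_div_of_le ht (by linarith)
    have hprod := mul_le_mul hsq hinv (by positivity) hsq0
    have hdiff : t - s ≤ 1 / (1 - t) - 1 / (1 - s) := by
      rw [div_sub_div _ _ ht.ne' hs.ne', le_div_iff₀ (by positivity)]
      have : (1 - t) * (1 - s) ≤ 1 := by nlinarith
      nlinarith
    nlinarith
end

section
/- For every integer n ≥ 4, the open interval (ln(2n)·QL(n), ln(2n)·QR(n) + 1) contains at most two integers, and σ_n is an integer lying in this interval. -/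
open Real in
theorem log_factorial_le_stirling {n : ℕ} (hn : n ≠ 0) :
    log (n.factorial : ℝ) ≤ n * log n - n + log n / 2 + 1 := by
  obtain ⟨m, rfl⟩ := Nat.exists_eq_succ_of_ne_zero hn
  have h := Stirling.log_stirlingSeq'_antitone (Nat.zero_le m)
  have hm : (0 : ℝ) < (m.succ : ℕ) := by positivity
  simp only [Function.comp_apply, Stirling.log_stirlingSeq_formula] at h
  rw [log_div hm.ne' (exp_pos 1).ne', log_mul two_ne_zero hm.ne', log_exp] at h
  norm_num at h ⊢
  linarith

open Real in
theorem log_pi_gt : 1.1385 < log π := by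
  rw [lt_log_iff_exp_lt pi_pos]
  have h1 : exp (1.1385 : ℝ) = exp 1 * exp (0.034625 : ℝ) ^ 4 := by
    rw [← exp_nat_mul, ← exp_add]; norm_num
  have h2 : exp (0.034625 : ℝ) ≤ 1 / (1 - 0.034625) :=
    exp_bound_div_one_sub_of_interval (by norm_num) (by norm_num)
  have h3 : exp (0.034625 : ℝ) ^ 4 ≤ (1 / (1 - 0.034625)) ^ 4 := by gcongr
  have h4 := exp_one_lt_d9
  have h5 := pi_gt_d2
  rw [h1]
  calc _ ≤ 2.7182818286 * (1 / (1 - 0.034625) : ℝ) ^ 4 := by gcongr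
    _ < 3.14 := by norm_num
    _ < π := h5

open Real in
theorem log_eight_lt : log 8 < 2.0794415424 := by
  have h : log (8 : ℝ) = 3 * log 2 := by
    rw [show (8 : ℝ) = 2 ^ 3 by norm_num, log_pow]; norm_num
  rw [h]
  linarith [log_two_lt_d9]

open Real in
theorem log_le_of_eight_le {y : ℝ} (hy : 8 ≤ y) : log y ≤ 0.25993020 * y := by
  have he : exp 1 ≤ (8 : ℝ) := by linarith [exp_one_lt_d9]
  have h := log_div_self_antitoneOn (Set.mem_Ici.2 he) (Set.mem_Ici.2 (he.trans hy)) hy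
  dsimp only at h
  have hy0 : 0 < y := by linarith
  rw [div_le_iff₀ hy0] at h
  nlinarith [log_eight_lt]

open Real in
theorem log_sq_le_of_eight_le {y : ℝ} (hy : 8 ≤ y) : log y ^ 2 ≤ 0.540510 * y := by
  have he : exp 2 ≤ (8 : ℝ) := by
    have h : exp (2 : ℝ) = exp 1 ^ 2 := by rw [← exp_nat_mul]; norm_num
    rw [h]
    calc exp 1 ^ 2 ≤ (2.7182818286 : ℝ) ^ 2 := by
          gcongr
          exact exp_one_lt_d9.le
      _ ≤ 8 := by norm_num
  have h := log_div_sqrt_antitoneOn (Set.mem_Ici.2 he) (Set.mem_Ici.2 (he.trans hy)) hy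
  dsimp only at h
  have hy0 : 0 < y := by linarith
  have h2 : (log y / √y) ^ 2 ≤ (log 8 / √8) ^ 2 :=
    pow_le_pow_left₀ (div_nonneg (log_nonneg (by linarith)) (sqrt_nonneg y)) h 2
  rw [div_pow, div_pow, sq_sqrt hy0.le, sq_sqrt (by norm_num), div_le_iff₀ hy0] at h2
  have h3 : log (8 : ℝ) ^ 2 ≤ 2.0794415424 ^ 2 :=
    pow_le_pow_left₀ (log_nonneg (by norm_num)) log_eight_lt.le 2
  nlinarith

theorem D_le_one {x : ℝ} (hx : 4 ≤ x) : D x ≤ 1 := by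
  have h1 := log_le_of_eight_le (y := 2 * x) (by linarith)
  have h2 := log_sq_le_of_eight_le (y := 2 * x) (by linarith)
  have hL : 0 < Real.log (2 * x) := Real.log_pos (by linarith)
  have hπ := log_pi_gt
  unfold D QR QL
  set L := Real.log (2 * x)
  set p := Real.log Real.pi
  have hx0 : 0 < x := by linarith
  have hd : 0 < 2 * x - L := by linarith
  have key : 2 * x * L * (2 + L) ≤ p * (2 * x - L) * (2 * x + L) := by
    have h3 : L * (2 + L) ≤ 1.0603704 * (2 * x) := by linarith
    have h4 : L ^ 2 ≤ (0.25993020 * (2 * x)) ^ 2 := pow_le_pow_left₀ hL.le h1 2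
    have h5 : 2 * x * (L * (2 + L)) ≤ 2 * x * (1.0603704 * (2 * x)) := by gcongr
    have h6 : 1.1385 * ((2 * x - L) * (2 * x + L)) ≤ p * ((2 * x - L) * (2 * x + L)) := by
      gcongr
    nlinarith
  have e : 1 - (L * ((2 / L + 1) * (x / (2 * x - L))) -
      L * (p / 2 / L + 1 / 2 * (1 + p / 2 / x))) =
      (p * (2 * x - L) * (2 * x + L) - 2 * x * L * (2 + L)) / (4 * x * (2 * x - L)) := by
    field_simp
    ring
  have : 0 ≤ (p * (2 * x - L) * (2 * x + L) - 2 * x * L * (2 + L)) / (4 * x * (2 * x - L)) :=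
    div_nonneg (by linarith) (by positivity)
  linarith

theorem encard_int_Ioo_le_two {a b : ℝ} (h : b - a ≤ 2) :
    {ℓ : ℤ | (ℓ : ℝ) ∈ Set.Ioo a b}.encard ≤ 2 := by
  have hs : {ℓ : ℤ | (ℓ : ℝ) ∈ Set.Ioo a b} ⊆ {⌊a⌋ + 1, ⌊a⌋ + 2} := by
    rintro ℓ ⟨h1, h2⟩
    have h3 : ⌊a⌋ < ℓ := Int.floor_lt.2 h1
    have h4 : ℓ < ⌊a⌋ + 3 := by
      have : (ℓ : ℝ) < ⌊a⌋ + 3 := by linarith [Int.lt_floor_add_one a]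
      exact_mod_cast this
    simp only [Set.mem_insert_iff, Set.mem_singleton_iff]
    omega
  refine (Set.encard_le_encard hs).trans ((Set.encard_insert_le _ _).trans ?_)
  rw [Set.encard_singleton]
  norm_num

theorem log_exp_one_mul_factorial_rpow (n : ℕ) :
    Real.log (Real.exp 1 * (n.factorial : ℝ) ^ ((1 : ℝ) / n)) =
      1 + Real.log n.factorial / n := by
  have hf : (0 : ℝ) < n.factorial := by exact_mod_cast n.factorial_pos
  rw [Real.log_mul (by positivity) (by positivity), Real.log_exp, Real.log_rpow hf]
  ring

theorem log_mul_QL_lt_sub {n : ℕ} (hn : 1 ≤ n) :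
    Real.log (2 * n) * QL n < Real.exp 1 * (n.factorial : ℝ) ^ ((1 : ℝ) / n) - n := by
  have hn1 : (1 : ℝ) ≤ n := by exact_mod_cast hn
  have hn0 : (0 : ℝ) < n := by linarith
  have hA : 0 < Real.exp 1 * (n.factorial : ℝ) ^ ((1 : ℝ) / n) := by positivity
  have hlog := log_exp_one_mul_factorial_rpow n
  have hst := Stirling.le_log_factorial_stirling (n := n) (by omega)
  set A := Real.exp 1 * (n.factorial : ℝ) ^ ((1 : ℝ) / n)
  have hL : 0 < Real.log (2 * n) := Real.log_pos (by linarith)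
  have hp : 0 < Real.log Real.pi := by linarith [log_pi_gt]
  have hL2 : Real.log (2 * n) = Real.log 2 + Real.log n := Real.log_mul two_ne_zero hn0.ne'
  rw [Real.log_mul two_ne_zero Real.pi_pos.ne'] at hst
  unfold QL
  set L := Real.log (2 * n)
  set p := Real.log Real.pi
  have hu : Real.log n + (L + p) / 2 / n ≤ Real.log A := by
    have h1 : (n * Real.log n - n + (L + p) / 2) / n ≤ Real.log n.factorial / n := by
      gcongr
      linarith
    have h2 : (n * Real.log n - n + (L + p) / 2) / n = Real.log n - 1 + (L + p) / 2 / n := by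
      field_simp
    linarith
  have hq := Real.quadratic_le_exp_of_nonneg (x := (L + p) / 2 / n) (by positivity)
  have hA' : n * Real.exp ((L + p) / 2 / n) ≤ A := by
    have := Real.exp_le_exp.2 hu
    rwa [Real.exp_add, Real.exp_log hn0, Real.exp_log hA] at this
  have hA'' : n * (1 + (L + p) / 2 / n + ((L + p) / 2 / n) ^ 2 / 2) ≤ A :=
    (mul_le_mul_of_nonneg_left hq hn0.le).trans hA'
  have e : n * (1 + (L + p) / 2 / n + ((L + p) / 2 / n) ^ 2 / 2) - n -
      L * (p / 2 / L + 1 / 2 * (1 + p / 2 / n)) = (L ^ 2 + p ^ 2) / (8 * n) := by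
    field_simp
    ring
  have : 0 < (L ^ 2 + p ^ 2) / (8 * n) := by positivity
  linarith

theorem sub_lt_log_mul_QR {n : ℕ} (hn : 4 ≤ n) :
    Real.exp 1 * (n.factorial : ℝ) ^ ((1 : ℝ) / n) - n < Real.log (2 * n) * QR n := by
  have hn4 : (4 : ℝ) ≤ n := by exact_mod_cast hn
  have hn0 : (0 : ℝ) < n := by linarith
  have hA : 0 < Real.exp 1 * (n.factorial : ℝ) ^ ((1 : ℝ) / n) := by positivity
  have hlog := log_exp_one_mul_factorial_rpow n
  have hst := log_factorial_le_stirling (n := n) (by omega)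
  set A := Real.exp 1 * (n.factorial : ℝ) ^ ((1 : ℝ) / n)
  have hL : 0 < Real.log (2 * n) := Real.log_pos (by linarith)
  have hL1 := log_le_of_eight_le (y := 2 * n) (by linarith)
  have hL2 : Real.log (2 * n) = Real.log 2 + Real.log n := Real.log_mul two_ne_zero hn0.ne'
  unfold QR
  set L := Real.log (2 * n)
  have hd : 0 < 2 * n - L := by linarith
  have hu : Real.log A ≤ Real.log n + (L / 2 + 0.7) / n := by
    have h1 : Real.log n.factorial / n ≤ (n * Real.log n - n + (L / 2 + 0.7)) / n := by
      gcongr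
      linarith [Real.log_two_gt_d9]
    have h2 : (n * Real.log n - n + (L / 2 + 0.7)) / n =
        Real.log n - 1 + (L / 2 + 0.7) / n := by
      field_simp
    linarith
  have h1 : 1 / (n + 1) ≤ Real.log (1 + 1 / n) := by
    refine le_of_eq_of_le ?_ (Real.one_sub_inv_le_log_of_pos (by positivity))
    field_simp
    ring
  have hy : 0 < 1 - L / (2 * n) := by
    rw [sub_pos, div_lt_one (by positivity)]
    linarith
  have h2 : Real.log (1 - L / (2 * n)) ≤ -(L / (2 * n)) := by
    linarith [Real.log_le_sub_one_of_pos hy]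
  have h3 : 0.7 / (n : ℝ) < 1 / (n + 1) := by
    rw [div_lt_div_iff₀ hn0 (by positivity)]
    linarith
  have h4 : Real.log A < Real.log (n * ((1 + 1 / n) / (1 - L / (2 * n)))) := by
    rw [Real.log_mul hn0.ne' (by positivity), Real.log_div (by positivity) hy.ne']
    have e : (L / 2 + 0.7) / n = L / (2 * n) + 0.7 / n := by
      field_simp
    linarith
  have h5 := (Real.log_lt_log_iff hA (by positivity)).1 h4
  have e : n * ((1 + 1 / n) / (1 - L / (2 * n))) - n =
      L * ((2 / L + 1) * (n / (2 * n - L))) := by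
    have : (1 : ℝ) - L / (2 * n) = (2 * n - L) / (2 * n) := by
      field_simp
    rw [this]
    field_simp
    linear_combination mul_inv_cancel₀ hd.ne'
  linarith

theorem stmt10 : ∀ n : ℕ, 4 ≤ n →
    {ℓ : ℤ | (ℓ : ℝ) ∈ Set.Ioo (Real.log (2 * n) * QL n) (Real.log (2 * n) * QR n + 1)}.encard ≤ 2 ∧
    ((sigma n : ℝ)) ∈ Set.Ioo (Real.log (2 * n) * QL n) (Real.log (2 * n) * QR n + 1) := by
  intro n hn
  have hn4 : (4 : ℝ) ≤ n := by exact_mod_cast hn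
  have hD := D_le_one hn4
  unfold D at hD
  have hl := log_mul_QL_lt_sub (n := n) (by omega)
  have hr := sub_lt_log_mul_QR hn
  have hQL : 0 < Real.log (2 * n) * QL n := by
    have hL : 0 < Real.log (2 * n) := Real.log_pos (by linarith)
    have hp : 0 < Real.log Real.pi := by linarith [log_pi_gt]
    unfold QL
    positivity
  obtain ⟨h1, h2⟩ := sigma_bounds (n := n) (by linarith)
  exact ⟨encard_int_Ioo_le_two (by linarith), by linarith, by linarith⟩
end

section
/- The function F is strictly increasing on the interval [2.6784, ∞). -/
noncomputable def F (x : ℝ) : ℝ := (1 + x) * Real.log (2 * x) / (2 * x - Real.log (2 * x))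

/-- The numerator of the derivative of `F`, in terms of `t = log (2 * x)`, is positive. -/
theorem sq_add_two_mul_lt_exp_add_two {t : ℝ} (ht : 0 ≤ t) : t ^ 2 + 2 * t < Real.exp t + 2 := by
  have h := Real.sum_le_exp_of_nonneg ht 5
  simp only [Finset.sum_range_succ, Finset.sum_range_zero, Nat.factorial] at h
  norm_num at h
  nlinarith [sq_nonneg (t ^ 2 + 2 * t - 8)]

theorem two_mul_sub_log_pos {x : ℝ} (hx : 0 < x) : 0 < 2 * x - Real.log (2 * x) := by
  linarith [Real.log_le_sub_one_of_pos (show 0 < 2 * x by positivity)]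

theorem hasDerivAt_F {x : ℝ} (hx : 0 < x) :
    HasDerivAt F ((2 * x + 2 - (Real.log (2 * x) ^ 2 + 2 * Real.log (2 * x))) /
      (2 * x - Real.log (2 * x)) ^ 2) x := by
  have hlin : HasDerivAt (fun y : ℝ => 2 * y) 2 x := by
    simpa using (hasDerivAt_id x).const_mul 2
  have hlog := hlin.log (by positivity)
  have hadd : HasDerivAt (fun y : ℝ => 1 + y) 1 x := (hasDerivAt_id x).const_add 1
  have hdiv := (hadd.mul hlog).div (hlin.sub hlog) (two_mul_sub_log_pos hx).ne'
  refine hdiv.congr_deriv ?_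
  simp only [Pi.mul_apply, Pi.sub_apply]
  congr 1
  field_simp
  ring

theorem stmt13 : StrictMonoOn F (Set.Ici (2.6784 : ℝ)) := by
  have hpos : ∀ x ∈ Set.Ici (2.6784 : ℝ), 0 < x := fun x hx => by
    linarith [Set.mem_Ici.mp hx]
  refine strictMonoOn_of_deriv_pos (convex_Ici _)
    (fun x hx => (hasDerivAt_F (hpos x hx)).continuousAt.continuousWithinAt) fun x hx => ?_
  have hx' : x ∈ Set.Ici (2.6784 : ℝ) := interior_subset hx
  have hx0 := hpos x hx'
  rw [(hasDerivAt_F hx0).deriv]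
  have ht := sq_add_two_mul_lt_exp_add_two
    (Real.log_nonneg (show (1 : ℝ) ≤ 2 * x by linarith [Set.mem_Ici.mp hx']))
  rw [Real.exp_log (by positivity)] at ht
  exact div_pos (by linarith) (pow_pos (two_mul_sub_log_pos hx0) 2)
end

section
/- The function H is strictly increasing on [0, ∞). -/
noncomputable def G (y : ℝ) : ℝ := (1 + Real.exp y / 2) * (y / (Real.exp y - y))
noncomputable def H (y : ℝ) : ℝ := (Real.log Real.pi / 2) * (1 + y / Real.exp y) + y / 2

theorem hasDerivAt_H (y : ℝ) :
    HasDerivAt H (Real.log Real.pi / 2 * ((1 - y) / Real.exp y) + 1 / 2) y := by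
  have hquot := (hasDerivAt_id y).div (Real.hasDerivAt_exp y) (Real.exp_ne_zero y)
  have hsum := ((hquot.const_add 1).const_mul (Real.log Real.pi / 2)).add
    ((hasDerivAt_id y).div_const 2)
  refine HasDerivAt.congr_deriv (f := H) hsum ?_
  have := Real.exp_ne_zero y
  simp only [id]
  field_simp

theorem stmt14 : StrictMonoOn H (Set.Ici (0 : ℝ)) := by
  refine strictMonoOn_of_deriv_pos (convex_Ici 0)
    (fun y _ => (hasDerivAt_H y).continuousAt.continuousWithinAt) fun y hy => ?_
  rw [interior_Ici, Set.mem_Ioi] at hy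
  rw [(hasDerivAt_H y).deriv]
  have hexp := Real.quadratic_le_exp_of_nonneg hy.le
  have hlog_nonneg : 0 ≤ Real.log Real.pi := Real.log_nonneg (by linarith [Real.pi_gt_three])
  have hlog_le : Real.log Real.pi ≤ 3 := by
    linarith [Real.log_le_sub_one_of_pos Real.pi_pos, Real.pi_le_four]
  have hnum : 0 < Real.log Real.pi * (1 - y) + Real.exp y := by
    rcases le_total y 1 with h | h
    · have := mul_nonneg hlog_nonneg (sub_nonneg.2 h)
      positivity
    · nlinarith [mul_nonneg (sub_nonneg.2 hlog_le) (sub_nonneg.2 h), sq_nonneg (y - 2)]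
  have hrw : Real.log Real.pi / 2 * ((1 - y) / Real.exp y) + 1 / 2
      = (Real.log Real.pi * (1 - y) + Real.exp y) / (2 * Real.exp y) := by
    have := Real.exp_ne_zero y
    field_simp
  rw [hrw]
  positivity
end

section
/- For all real y ≥ 6.06521, G(y + ln 3) < H(y). -/
theorem exp_lower_bound {y : ℝ} (hy : 6.06 ≤ y) :
    420 * (1 + (y - 6.06) + (y - 6.06) ^ 2 / 2) ≤ Real.exp y := by
  have h6 : (2.718 : ℝ) ^ 6 ≤ Real.exp 6 := by
    have h : Real.exp 6 = Real.exp 1 ^ 6 := by rw [← Real.exp_nat_mul]; norm_num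
    rw [h]
    exact pow_le_pow_left₀ (by norm_num) (by linarith [Real.exp_one_gt_d9]) 6
  have h06 : (1.06 : ℝ) ≤ Real.exp 0.06 := by linarith [Real.add_one_le_exp (0.06 : ℝ)]
  have h606 : (420 : ℝ) ≤ Real.exp 6 * Real.exp 0.06 :=
    le_trans (by norm_num) (mul_le_mul h6 h06 (by norm_num) (Real.exp_pos 6).le)
  have hq := Real.quadratic_le_exp_of_nonneg (sub_nonneg.2 hy)
  have hsplit : Real.exp y = Real.exp 6 * Real.exp 0.06 * Real.exp (y - 6.06) := by
    rw [← Real.exp_add, ← Real.exp_add]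
    congr 1
    ring
  rw [hsplit]
  exact mul_le_mul h606 hq (by nlinarith) (by positivity)

theorem log_three_le : Real.log 3 ≤ 1.1 := by
  rw [Real.log_le_iff_le_exp (by norm_num)]
  have hq := Real.quadratic_le_exp_of_nonneg (show (0 : ℝ) ≤ 0.1 by norm_num)
  have hsplit : Real.exp 1.1 = Real.exp 1 * Real.exp 0.1 := by
    rw [← Real.exp_add]; norm_num
  rw [hsplit]
  nlinarith [Real.exp_one_gt_d9]

theorem log_pi_sub_log_three_ge : 0.045 ≤ Real.log Real.pi - Real.log 3 := by
  have hpi := Real.pi_gt_d4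
  rw [← Real.log_div Real.pi_ne_zero (by norm_num)]
  have h := Real.one_sub_inv_le_log_of_pos (show 0 < Real.pi / 3 by positivity)
  have h3 : (Real.pi / 3)⁻¹ ≤ 0.955 := by
    rw [inv_div, div_le_iff₀ Real.pi_pos]
    linarith
  linarith

theorem stmt16 : ∀ y : ℝ, (6.06521 : ℝ) ≤ y → G (y + Real.log 3) < H y := by
  intro y hy
  have hE := exp_lower_bound (show 6.06 ≤ y by linarith)
  have hL := log_three_le
  have hL1 : 1 ≤ Real.log 3 := by
    rw [Real.le_log_iff_exp_le (by norm_num)]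
    linarith [Real.exp_one_lt_d9]
  have hc := log_pi_sub_log_three_ge
  have hP : Real.log Real.pi ≤ 2.2 := by
    linarith [Real.log_le_sub_one_of_pos Real.pi_pos, Real.pi_lt_d4]
  unfold G H
  rw [Real.exp_add, Real.exp_log (by norm_num)]
  generalize Real.exp y = E at *
  generalize Real.log Real.pi = P at *
  generalize Real.log 3 = L at *
  obtain ⟨u, rfl⟩ : ∃ u, y = 6.06 + u := ⟨y - 6.06, by ring⟩
  have hu : 0 ≤ u := by linarith
  rw [show 6.06 + u - 6.06 = u by ring] at hE
  set y := 6.06 + u with hy'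
  set t := y + L with ht
  have htu : t ≤ 7.16 + u := by linarith
  have ht0 : 0 < t := by linarith
  have hE420 : 420 ≤ E := by nlinarith
  have hden : 0 < E * 3 - t := by nlinarith
  have ht2 : t ^ 2 ≤ (7.16 + u) ^ 2 := pow_le_pow_left₀ ht0.le htu 2
  have hyt : P * (y * t) ≤ 2.2 * (y * (7.16 + u)) :=
    mul_le_mul hP (mul_le_mul_of_nonneg_left htu (by linarith)) (by positivity) (by norm_num)
  have hPy : y ≤ P * y := by nlinarith
  have hbound : 0 < 3 * 0.045 * E + 3 * (P * y) - 0.045 * t - t ^ 2 - 2 * t - P * (y * t) / 420 := by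
    rw [hy'] at hyt hPy
    nlinarith
  have hmul : P * (y * t) ≤ P * (y * t) / 420 * E := by
    have : 0 ≤ P * (y * t) := mul_nonneg (by linarith) (mul_nonneg (by linarith) ht0.le)
    nlinarith
  have hkey : t * (t + 2) * E < ((P - L) * E + P * y) * (E * 3 - t) := by
    have h1 : 0.045 * E * (E * 3 - t) ≤ (P - L) * E * (E * 3 - t) := by gcongr
    have h2 := mul_pos hbound (show 0 < E by linarith)
    nlinarith
  have hE0 : 0 < E := by linarith
  have hdiff : P / 2 * (1 + y / E) + y / 2 - (1 + E * 3 / 2) * (t / (E * 3 - t)) =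
      (((P - L) * E + P * y) * (E * 3 - t) - t * (t + 2) * E) / (2 * E * (E * 3 - t)) := by
    have hy2 : y = t - L := by linarith
    rw [hy2]
    field_simp
    ring
  have hpos := div_pos (sub_pos.2 hkey) (show 0 < 2 * E * (E * 3 - t) by positivity)
  linarith
end

section
/- For all real x ≥ 215.30655, F(3x) < ln(2x)·QL(x). -/
theorem one_le_log_pi : 1 ≤ Real.log Real.pi := by
  rw [Real.le_log_iff_exp_le Real.pi_pos]
  linarith [Real.exp_one_lt_d9, Real.pi_gt_three]

theorem seven_le_log : 7 ≤ Real.log 1291.8 := by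
  rw [Real.le_log_iff_exp_le (by norm_num)]
  have h : Real.exp 7 = Real.exp 1 ^ 7 := by rw [← Real.exp_nat_mul]; norm_num
  rw [h]
  calc Real.exp 1 ^ 7 ≤ 2.7182818286 ^ 7 := by
        gcongr; exact Real.exp_one_lt_d9.le
    _ ≤ 1291.8 := by norm_num

theorem log_le_seven : Real.log 1291.8 ≤ 7.17 := by
  rw [Real.log_le_iff_le_exp (by norm_num)]
  have h : Real.exp 7.17 = Real.exp 1 ^ 7 * Real.exp 0.17 := by
    rw [← Real.exp_nat_mul, ← Real.exp_add]; norm_num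
  rw [h]
  have h7 : (2.7182818283 : ℝ) ^ 7 ≤ Real.exp 1 ^ 7 := by
    gcongr; exact Real.exp_one_gt_d9.le
  have hq := Real.quadratic_le_exp_of_nonneg (show (0 : ℝ) ≤ 0.17 by norm_num)
  calc (1291.8 : ℝ) ≤ 2.7182818283 ^ 7 * (1 + 0.17 + 0.17 ^ 2 / 2) := by norm_num
    _ ≤ _ := by gcongr

theorem stmt17 : ∀ x : ℝ, (215.30655 : ℝ) ≤ x →
    F (3 * x) < Real.log (2 * x) * QL x := by
  intro x hx
  have hx0 : 0 < x := by linarith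
  set L := Real.log (2 * x) with hL
  set c := Real.log 3 with hc
  set p := Real.log Real.pi with hp
  set s := Real.log (6 * x) - Real.log 1291.8 with hs
  have hM : Real.log (2 * (3 * x)) = L + c := by
    rw [hL, hc, ← Real.log_mul (by positivity) (by norm_num)]; ring_nf
  have hM' : Real.log (6 * x) = L + c := by rw [← hM]; ring_nf
  have hc1 : c ≤ 1.1 := log_three_le
  have hp1 : 1 ≤ p := one_le_log_pi
  have hpc : 0.045 ≤ p - c := log_pi_sub_log_three_ge
  have hlo := seven_le_log
  have hhi := log_le_seven
  have hs0 : 0 ≤ s := sub_nonneg.2 (Real.log_le_log (by norm_num) (by linarith))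
  have hexp : Real.exp s = 6 * x / 1291.8 := by
    rw [hs, Real.exp_sub, Real.exp_log (by positivity), Real.exp_log (by norm_num)]
  have hq := Real.quadratic_le_exp_of_nonneg hs0
  rw [hexp, le_div_iff₀ (by norm_num)] at hq
  have hMlo : 7 + s ≤ L + c := by linarith
  have hMhi : L + c ≤ 7.17 + s := by linarith
  have hMx : L + c ≤ 0.04 * x := by nlinarith [sq_nonneg s]
  have hL0 : 5.9 + s ≤ L := by linarith
  have hden : 0 < 6 * x - (L + c) := by linarith
  have hQ : L * QL x = p / 2 + L / 2 + p * L / (4 * x) := by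
    have : L ≠ 0 := by linarith
    simp only [QL, ← hL, ← hp]
    field_simp
    ring
  have hF : F (3 * x) = (1 + 3 * x) * (L + c) / (6 * x - (L + c)) := by
    simp only [F, hM]; ring_nf
  rw [hQ, hF, div_lt_iff₀ hden]
  have hα : L * 2.98 / 2 ≤ p * L / (4 * x) * (6 * x - (L + c)) := by
    rw [div_mul_eq_mul_div, le_div_iff₀ (by positivity)]
    have h1 : L * (5.96 * x) ≤ L * (6 * x - (L + c)) := by
      gcongr
      · linarith
      · linarith
    have h2 : 0 ≤ L * (6 * x - (L + c)) := mul_nonneg (by linarith) hden.le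
    nlinarith [mul_nonneg (sub_nonneg.2 hp1) h2]
  have hk : 0.0225 * (6 * x - (L + c)) ≤ (p - c) / 2 * (6 * x - (L + c)) := by
    gcongr; linarith
  have hsq : (L + c) ^ 2 ≤ (7.17 + s) ^ 2 := by
    gcongr; linarith
  nlinarith [sq_nonneg s]
end
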